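/- arXiv:2109.08666 — 3 statements merged into one kernel-verified Lean document; each statement's English description precedes it below -/
import Mathlib

section
/- Let W ∈ ℝ^{n×n} be a real symmetric matrix with spectral decomposition W = Q diag(μ₁, …, μ_n) Qᵀ, where Q is orthogonal and μ₁, …, μ_n are the eigenvalues of W, and let σ > 0. Then the function Y ↦ -σ^{-1} log det(Y) + (1/2)‖W - Y‖_F², restricted to real symmetric positive definite matrices Y, has a unique minimizer, equal to Q diag( (μ₁ + √(μ₁² + 4σ^{-1}))/2, …, (μ_n + √(μ_n² + 4σ^{-1}))/2 ) Qᵀ. -/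
open Matrix

lemma aux_logdet {n : ℕ} (M : Matrix (Fin n) (Fin n) ℝ) (hM : M.PosDef) :
    Real.log M.det ≤ M.trace - n := by
  rw [hM.1.det_eq_prod_eigenvalues, hM.1.trace_eq_sum_eigenvalues]
  simp only [RCLike.ofReal_real_eq_id, id]
  rw [Real.log_prod (fun i _ => (hM.eigenvalues_pos i).ne')]
  calc _ ≤ ∑ i, (hM.1.eigenvalues i - 1) :=
        Finset.sum_le_sum fun i _ => Real.log_le_sub_one_of_pos (hM.eigenvalues_pos i)
    _ = _ := by simp

lemma aux_logdet2 {n : ℕ} (Z : Matrix (Fin n) (Fin n) ℝ) (hZ : Z.PosDef) (d : Fin n → ℝ)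
    (hd : ∀ i, 0 < d i) :
    Real.log Z.det ≤ Real.log (Matrix.diagonal d).det + ∑ i, (Z i i / d i - 1) := by
  set B : Matrix (Fin n) (Fin n) ℝ := Matrix.diagonal (fun i => (Real.sqrt (d i))⁻¹) with hB
  have hs : ∀ i, 0 < Real.sqrt (d i) := fun i => Real.sqrt_pos.2 (hd i)
  have hBu : IsUnit B := by
    rw [Matrix.isUnit_iff_isUnit_det, hB, Matrix.det_diagonal, isUnit_iff_ne_zero]
    exact Finset.prod_ne_zero_iff.2 fun i _ => (inv_pos.2 (hs i)).ne'
  have hM : (Bᴴ * Z * B).PosDef :=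
    hZ.conjTranspose_mul_mul_same (Matrix.mulVec_injective_of_isUnit hBu)
  have hBh : Bᴴ = B := by simp [hB]
  rw [hBh] at hM
  have h := aux_logdet _ hM
  have hpd : 0 < ∏ i, d i := Finset.prod_pos fun i _ => hd i
  have hdet : (B * Z * B).det = Z.det / ∏ i, d i := by
    rw [Matrix.det_mul, Matrix.det_mul, hB, Matrix.det_diagonal, Finset.prod_inv_distrib]
    have : (∏ i, d i) = (∏ i, Real.sqrt (d i)) * ∏ i, Real.sqrt (d i) := by
      rw [← Finset.prod_mul_distrib]
      exact Finset.prod_congr rfl fun i _ => (Real.mul_self_sqrt (hd i).le).symm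
    rw [this]
    have : (∏ i, Real.sqrt (d i)) ≠ 0 := Finset.prod_ne_zero_iff.2 fun i _ => (hs i).ne'
    field_simp
  have htr : (B * Z * B).trace - n = ∑ i, (Z i i / d i - 1) := by
    rw [Finset.sum_sub_distrib]
    simp only [Matrix.trace, Matrix.diag, hB, Matrix.mul_diagonal, Matrix.diagonal_mul]
    congr 1
    · refine Finset.sum_congr rfl fun i _ => ?_
      have h1 := Real.mul_self_sqrt (hd i).le
      have h2 := (hs i).ne'
      conv_rhs => rw [← h1]
      field_simp
    · simp
  rw [hdet, htr, Real.log_div hZ.det_pos.ne' hpd.ne'] at h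
  rw [Matrix.det_diagonal]
  linarith

lemma aux_frob {n : ℕ} (A : Matrix (Fin n) (Fin n) ℝ) :
    ∑ p, ∑ q, (A p q) ^ 2 = (Aᵀ * A).trace := by
  simp only [Matrix.trace, Matrix.diag, Matrix.mul_apply, Matrix.transpose_apply]
  rw [Finset.sum_comm]
  simp only [sq]

lemma aux_frob_conj {n : ℕ} (Q A : Matrix (Fin n) (Fin n) ℝ) (hQ : Qᵀ * Q = 1) :
    ∑ p, ∑ q, ((Q * A * Qᵀ) p q) ^ 2 = ∑ p, ∑ q, (A p q) ^ 2 := by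
  rw [aux_frob, aux_frob]
  have : (Q * A * Qᵀ)ᵀ * (Q * A * Qᵀ) = Q * (Aᵀ * A) * Qᵀ := by
    simp only [Matrix.transpose_mul, Matrix.transpose_transpose]
    calc _ = Q * Aᵀ * (Qᵀ * Q) * A * Qᵀ := by simp only [Matrix.mul_assoc]
      _ = _ := by rw [hQ]; simp only [Matrix.mul_assoc, Matrix.one_mul]
  rw [this, Matrix.trace_mul_comm, ← Matrix.mul_assoc, hQ, Matrix.one_mul]

lemma aux_diag {n : ℕ} (s : ℝ) (hs : 0 < s) (μ d : Fin n → ℝ) (hd : ∀ i, 0 < d i)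
    (hμ : ∀ i, d i - μ i = s / d i) (Z : Matrix (Fin n) (Fin n) ℝ) (hZ : Z.PosDef)
    (hne : Z ≠ Matrix.diagonal d) :
    -s * Real.log (Matrix.diagonal d).det
        + (1 / 2) * ∑ p, ∑ q, ((Matrix.diagonal μ - Matrix.diagonal d) p q) ^ 2
      < -s * Real.log Z.det + (1 / 2) * ∑ p, ∑ q, ((Matrix.diagonal μ - Z) p q) ^ 2 := by
  have h1 := mul_le_mul_of_nonneg_left (aux_logdet2 Z hZ d hd) hs.le
  have hpos : 0 < ∑ p, ∑ q, ((Matrix.diagonal d - Z) p q) ^ 2 := by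
    obtain ⟨i, j, hij⟩ : ∃ i j, Z i j ≠ Matrix.diagonal d i j := by
      by_contra! h
      exact hne (Matrix.ext h)
    refine Finset.sum_pos' (fun _ _ => Finset.sum_nonneg fun _ _ => sq_nonneg _)
      ⟨i, Finset.mem_univ _, Finset.sum_pos' (fun _ _ => sq_nonneg _) ⟨j, Finset.mem_univ _, ?_⟩⟩
    rw [Matrix.sub_apply]
    exact sq_pos_of_ne_zero (sub_ne_zero.2 hij.symm)
  have hexp : ∑ p, ∑ q, ((Matrix.diagonal μ - Z) p q) ^ 2
      = ∑ p, ∑ q, ((Matrix.diagonal μ - Matrix.diagonal d) p q) ^ 2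
        + ∑ p, ∑ q, ((Matrix.diagonal d - Z) p q) ^ 2
        + 2 * (s * ∑ i, (Z i i / d i - 1)) := by
    have hc : s * ∑ i, (Z i i / d i - 1)
        = ∑ p, ∑ q, (Matrix.diagonal μ - Matrix.diagonal d) p q * (Matrix.diagonal d - Z) p q := by
      rw [Finset.mul_sum]
      refine Finset.sum_congr rfl fun p _ => ?_
      rw [Finset.sum_eq_single p]
      · simp only [Matrix.sub_apply, Matrix.diagonal_apply_eq]
        have h2 : μ p - d p = - (s / d p) := by linarith [hμ p]
        have h3 := (hd p).ne'
        rw [h2]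
        field_simp
        ring
      · intro q _ hq
        simp [Matrix.sub_apply, Matrix.diagonal_apply_ne _ hq.symm]
      · simp
    rw [hc]
    simp only [Finset.mul_sum, ← Finset.sum_add_distrib]
    refine Finset.sum_congr rfl fun p _ => Finset.sum_congr rfl fun q _ => ?_
    simp only [Matrix.sub_apply]
    ring
  rw [hexp]
  linarith

/-- Let `W = Q diag(μ) Qᵀ` be a spectral decomposition of a real symmetric matrix `W`
(`Q` orthogonal), and let `σ > 0`. Then `Y ↦ -σ⁻¹ log det Y + (1/2)‖W - Y‖_F²`,
restricted to real symmetric positive definite `Y`, has the unique minimizer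
`Q diag((μᵢ + √(μᵢ² + 4σ⁻¹))/2) Qᵀ`. -/
theorem prox_neg_logdet {n : ℕ} (σ : ℝ) (hσ : 0 < σ)
    (W Q : Matrix (Fin n) (Fin n) ℝ) (μ : Fin n → ℝ)
    (hQ : Qᵀ * Q = 1) (hW : W = Q * Matrix.diagonal μ * Qᵀ) :
    let Ystar := Q * Matrix.diagonal
        (fun i => (μ i + Real.sqrt ((μ i) ^ 2 + 4 * σ⁻¹)) / 2) * Qᵀ
    Ystar.PosDef ∧
    (∀ Y : Matrix (Fin n) (Fin n) ℝ, Y.PosDef → Y ≠ Ystar →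
      -σ⁻¹ * Real.log Ystar.det + (1 / 2) * ∑ p : Fin n, ∑ q : Fin n, (W p q - Ystar p q) ^ 2
        < -σ⁻¹ * Real.log Y.det + (1 / 2) * ∑ p : Fin n, ∑ q : Fin n, (W p q - Y p q) ^ 2) := by
  intro Ystar
  set d : Fin n → ℝ := fun i => (μ i + Real.sqrt ((μ i) ^ 2 + 4 * σ⁻¹)) / 2 with hdd
  have hs : 0 < σ⁻¹ := inv_pos.2 hσ
  have hd : ∀ i, 0 < d i := by
    intro i
    have : |μ i| < Real.sqrt ((μ i) ^ 2 + 4 * σ⁻¹) := by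
      rw [← Real.sqrt_sq_eq_abs]
      exact Real.sqrt_lt_sqrt (sq_nonneg _) (by linarith)
    have h2 := neg_abs_le (μ i)
    simp only [hdd]
    linarith
  have hμ : ∀ i, d i - μ i = σ⁻¹ / d i := by
    intro i
    rw [eq_div_iff (hd i).ne']
    have h := Real.sq_sqrt (show 0 ≤ (μ i) ^ 2 + 4 * σ⁻¹ by positivity)
    simp only [hdd]
    linear_combination h / 4
  have hQ' : Q * Qᵀ = 1 := mul_eq_one_comm.1 hQ
  have hYs : Ystar = Q * Matrix.diagonal d * Qᵀ := rfl
  have hQu : IsUnit Q := IsUnit.of_mul_eq_one _ hQ'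
  have hQtu : IsUnit Qᵀ := IsUnit.of_mul_eq_one _ hQ
  have hdet : ∀ A : Matrix (Fin n) (Fin n) ℝ, (Q * A * Qᵀ).det = A.det := by
    intro A
    rw [Matrix.det_mul, Matrix.det_mul, mul_comm Q.det, mul_assoc, ← Matrix.det_mul, hQ',
      Matrix.det_one, mul_one]
  refine ⟨?_, ?_⟩
  · have h := (Matrix.PosDef.diagonal hd).conjTranspose_mul_mul_same
      (Matrix.mulVec_injective_of_isUnit hQtu)
    simpa [hYs, Matrix.conjTranspose_eq_transpose_of_trivial] using h
  · intro Y hY hne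
    obtain ⟨Z, hZ⟩ : ∃ Z, Z = Qᵀ * Y * Q := ⟨_, rfl⟩
    have hYZ : Y = Q * Z * Qᵀ := by
      rw [hZ]
      calc Y = (Q * Qᵀ) * Y * (Q * Qᵀ) := by rw [hQ']; simp
        _ = _ := by simp only [Matrix.mul_assoc]
    have hZp : Z.PosDef := by
      have h := hY.conjTranspose_mul_mul_same (Matrix.mulVec_injective_of_isUnit hQu)
      simpa [hZ, Matrix.conjTranspose_eq_transpose_of_trivial] using h
    have hZne : Z ≠ Matrix.diagonal d := by
      intro h
      exact hne (by rw [hYZ, h])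
    have key := aux_diag σ⁻¹ hs μ d hd hμ Z hZp hZne
    rw [← aux_frob_conj Q _ hQ, ← aux_frob_conj Q (Matrix.diagonal μ - Z) hQ,
      ← hdet, ← hdet Z] at key
    simp only [Matrix.mul_sub, Matrix.sub_mul] at key
    rw [← hW, ← hYZ, ← hYs] at key
    simpa only [Matrix.sub_apply] using key
end

section
/- Let N ≥ 1, γ > 0, λ₁ ≥ 0, and λ₂ ≥ γ^{-1}λ₁. Then the map T : ℝ^N → ℝ^N defined by T(w) := γ^{-1}λ₁ · soft_γ(w) + (λ₂ - γ^{-1}λ₁) w is Lipschitz continuous with Lipschitz constant λ₂, i.e., ‖T(w) - T(w')‖₂ ≤ λ₂‖w - w'‖₂ for all w, w' ∈ ℝ^N. In particular, the gradient of F(w) := -λ₁ ^γ‖·‖₁(w) + (λ₂/2)‖w‖₂² is λ₂-Lipschitz continuous. -/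
/-- Componentwise soft-thresholding with threshold `γ`. -/
noncomputable def soft (γ t : ℝ) : ℝ :=
  if γ ≤ t then t - γ else if t ≤ -γ then t + γ else 0

theorem soft_nonexp (γ a b : ℝ) (hγ : 0 < γ) : |soft γ a - soft γ b| ≤ |a - b| := by
  rw [abs_le]
  have h1 := le_abs_self (a - b)
  have h2 := neg_abs_le (a - b)
  have h3 := abs_nonneg (a - b)
  unfold soft
  split_ifs <;> constructor <;> linarith

/-- For `γ > 0`, `λ₁ ≥ 0`, `λ₂ ≥ γ⁻¹λ₁`, the map
`T(w) := γ⁻¹λ₁ soft_γ(w) + (λ₂ - γ⁻¹λ₁)w` (which is the gradient of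
`F(w) = -λ₁ ^γ‖·‖₁(w) + (λ₂/2)‖w‖₂²`) is Lipschitz continuous with constant `λ₂`:
`‖T(w) - T(w')‖₂ ≤ λ₂ ‖w - w'‖₂` for all `w, w'`. -/
theorem gradF_lipschitz {N : ℕ} (hN : 1 ≤ N) (γ lam₁ lam₂ : ℝ) (hγ : 0 < γ)
    (hlam₁ : 0 ≤ lam₁) (hlam₂ : γ⁻¹ * lam₁ ≤ lam₂) (w w' : Fin N → ℝ) :
    Real.sqrt (∑ i, ((γ⁻¹ * lam₁ * soft γ (w i) + (lam₂ - γ⁻¹ * lam₁) * w i)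
        - (γ⁻¹ * lam₁ * soft γ (w' i) + (lam₂ - γ⁻¹ * lam₁) * w' i)) ^ 2)
      ≤ lam₂ * Real.sqrt (∑ i, (w i - w' i) ^ 2) := by
  have hc : 0 ≤ γ⁻¹ * lam₁ := by positivity
  have hl : 0 ≤ lam₂ := hc.trans hlam₂
  rw [← Real.sqrt_sq hl, ← Real.sqrt_mul (sq_nonneg _), Real.sqrt_sq hl]
  apply Real.sqrt_le_sqrt
  rw [Finset.mul_sum]
  apply Finset.sum_le_sum
  intro i _
  rw [← mul_pow]
  apply sq_le_sq.mpr
  rw [abs_mul, abs_of_nonneg hl]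
  have hs := soft_nonexp γ (w i) (w' i) hγ
  generalize γ⁻¹ * lam₁ = c at *
  have e : (c * soft γ (w i) + (lam₂ - c) * w i) - (c * soft γ (w' i) + (lam₂ - c) * w' i)
      = c * (soft γ (w i) - soft γ (w' i)) + (lam₂ - c) * (w i - w' i) := by ring
  rw [e]
  refine (abs_add_le _ _).trans ?_
  rw [abs_mul, abs_mul, abs_of_nonneg hc, abs_of_nonneg (sub_nonneg.mpr hlam₂)]
  nlinarith [mul_le_mul_of_nonneg_left hs hc]
end

section
/- Let n ≥ 2 and let L be the combinatorial-graph-Laplacian operator. Then for every w ∈ ℝ^{n(n-1)/2}, ‖L(w)‖_F² ≤ 2n ‖w‖₂², where ‖·‖_F is the Frobenius norm and ‖·‖₂ the Euclidean norm. -/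
/-- Entry of the weight function associated to an upper-triangular weight vector. -/
def wEnt {n : ℕ} (w : {pq : Fin n × Fin n // pq.1 < pq.2} → ℝ) (p q : Fin n) : ℝ :=
  if h : p < q then w ⟨(p, q), h⟩ else if h' : q < p then w ⟨(q, p), h'⟩ else 0

/-- The combinatorial-graph-Laplacian operator. -/
def Lap {n : ℕ} (w : {pq : Fin n × Fin n // pq.1 < pq.2} → ℝ) :
    Matrix (Fin n) (Fin n) ℝ :=
  Matrix.of fun p q => if p = q then ∑ r : Fin n, wEnt w p r else - wEnt w p q

theorem wEnt_sq_sum {n : ℕ} (w : {pq : Fin n × Fin n // pq.1 < pq.2} → ℝ) :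
    ∑ p : Fin n, ∑ q : Fin n, (wEnt w p q) ^ 2 = 2 * ∑ i, (w i) ^ 2 := by
  let f : Fin n × Fin n → ℝ := fun x => if h : x.1 < x.2 then (w ⟨x, h⟩) ^ 2 else 0
  have h1 : ∀ p q, (wEnt w p q) ^ 2 = f (p, q) + f (q, p) := by
    intro p q
    rcases lt_trichotomy p q with h | h | h
    · simp [wEnt, f, h, h.not_gt]
    · simp [wEnt, f, h]
    · simp [wEnt, f, h, h.not_gt]
  have h2 : ∑ p : Fin n, ∑ q : Fin n, f (p, q) = ∑ i, (w i) ^ 2 := by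
    rw [← Fintype.sum_prod_type (f := f)]
    have h3 : ∑ x : Fin n × Fin n, f x
        = ∑ x ∈ Finset.univ.filter (fun x : Fin n × Fin n => x.1 < x.2), f x := by
      rw [Finset.sum_filter]
      refine Finset.sum_congr rfl fun x _ => ?_
      by_cases h : x.1 < x.2 <;> simp [f, h]
    rw [h3, Finset.sum_subtype (p := fun x : Fin n × Fin n => x.1 < x.2) _ (by simp)]
    refine Finset.sum_congr rfl fun x _ => ?_
    simp [f, x.2]
  simp_rw [h1, Finset.sum_add_distrib]
  rw [Finset.sum_comm (f := fun p q => f (q, p)), h2]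
  ring

theorem row_bound {n : ℕ} (w : {pq : Fin n × Fin n // pq.1 < pq.2} → ℝ) (p : Fin n) :
    ∑ q : Fin n, (Lap w p q) ^ 2 ≤ n * ∑ q : Fin n, (wEnt w p q) ^ 2 := by
  have h0 : wEnt w p p = 0 := by simp [wEnt]
  have hp := Finset.mem_univ p
  have hd : Lap w p p = ∑ r ∈ Finset.univ.erase p, wEnt w p r := by
    rw [Finset.sum_erase _ h0]; simp [Lap]
  have ho : ∑ q ∈ Finset.univ.erase p, (Lap w p q) ^ 2
      = ∑ q ∈ Finset.univ.erase p, (wEnt w p q) ^ 2 := by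
    refine Finset.sum_congr rfl fun q hq => ?_
    have : p ≠ q := (Finset.ne_of_mem_erase hq).symm
    simp [Lap, this]
  rw [← Finset.add_sum_erase _ _ hp, ho, hd,
    ← Finset.add_sum_erase _ (fun q => (wEnt w p q) ^ 2) hp, h0]
  have hc := sq_sum_le_card_mul_sum_sq (s := Finset.univ.erase p) (f := fun r => wEnt w p r)
  have hcard : (((Finset.univ.erase p).card : ℕ) : ℝ) + 1 = n := by
    have := Finset.card_erase_add_one hp
    rw [Finset.card_univ, Fintype.card_fin] at this
    exact_mod_cast this
  rw [← hcard]
  linarith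

/-- Operator-norm bound for the CGL operator: `‖L(w)‖_F² ≤ 2n ‖w‖₂²`. -/
theorem cgl_frobenius_bound {n : ℕ} (hn : 2 ≤ n)
    (w : {pq : Fin n × Fin n // pq.1 < pq.2} → ℝ) :
    ∑ p : Fin n, ∑ q : Fin n, (Lap w p q) ^ 2
      ≤ 2 * n * ∑ i : {pq : Fin n × Fin n // pq.1 < pq.2}, (w i) ^ 2 := by
  refine (Finset.sum_le_sum fun p _ => row_bound w p).trans ?_
  rw [← Finset.mul_sum, wEnt_sq_sum]
  linarith
end
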